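/- arXiv:1401.0485 — 3 statements merged into one kernel-verified Lean document; each statement's English description precedes it below -/
import Mathlib

section
/- Let P and A be complex n×n matrices, let γ and s be real numbers with γ ≠ 0, and suppose the vectors (u₁,u₂,v₁,v₂) and (u₁',u₂',v₁',v₂') in ℂⁿ each form a singular pair for F = [[P,0],[γA,P]] with singular value s. Then u₂ᴴ A v₁' = conj(u₂'ᴴ A v₁). -/
open Matrix

lemma key_aux {n : ℕ} (P A : Matrix (Fin n) (Fin n) ℂ) (γ s : ℝ)
    (u₂ v₂ u₂' v₁' v₂' : Fin n → ℂ)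
    (h4 : Pᴴ.mulVec u₂ = (s : ℂ) • v₂)
    (h2' : (γ : ℂ) • A.mulVec v₁' + P.mulVec v₂' = (s : ℂ) • u₂') :
    (γ : ℂ) * (star u₂ ⬝ᵥ A.mulVec v₁') =
      (s : ℂ) * (star u₂ ⬝ᵥ u₂') - (s : ℂ) * (star v₂ ⬝ᵥ v₂') := by
  have a := congrArg (fun x => star u₂ ⬝ᵥ x) h2'
  have b : star u₂ ⬝ᵥ P.mulVec v₂' = (s : ℂ) * (star v₂ ⬝ᵥ v₂') := by
    have c := congrArg star h4
    rw [Matrix.star_mulVec, conjTranspose_conjTranspose] at c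
    rw [Matrix.dotProduct_mulVec, c, star_smul, smul_dotProduct]
    simp
  simp only [dotProduct_add, dotProduct_smul, smul_eq_mul] at a
  rw [b] at a
  linear_combination a

/-- For two singular pairs of `F = [[P,0],[γA,P]]` with singular value `s` and `γ ≠ 0`,
`u₂ᴴ A v₁' = conj (u₂'ᴴ A v₁)`. -/
theorem stmt_1 (n : ℕ) (P A : Matrix (Fin n) (Fin n) ℂ) (γ s : ℝ) (hγ : γ ≠ 0)
    (u₁ u₂ v₁ v₂ u₁' u₂' v₁' v₂' : Fin n → ℂ)
    (h1 : P.mulVec v₁ = (s : ℂ) • u₁)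
    (h2 : (γ : ℂ) • A.mulVec v₁ + P.mulVec v₂ = (s : ℂ) • u₂)
    (h3 : Pᴴ.mulVec u₁ + (γ : ℂ) • Aᴴ.mulVec u₂ = (s : ℂ) • v₁)
    (h4 : Pᴴ.mulVec u₂ = (s : ℂ) • v₂)
    (h1' : P.mulVec v₁' = (s : ℂ) • u₁')
    (h2' : (γ : ℂ) • A.mulVec v₁' + P.mulVec v₂' = (s : ℂ) • u₂')
    (h3' : Pᴴ.mulVec u₁' + (γ : ℂ) • Aᴴ.mulVec u₂' = (s : ℂ) • v₁')
    (h4' : Pᴴ.mulVec u₂' = (s : ℂ) • v₂') :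
    star u₂ ⬝ᵥ A.mulVec v₁' = (starRingEnd ℂ) (star u₂' ⬝ᵥ A.mulVec v₁) := by
  have e := key_aux P A γ s u₂ v₂ u₂' v₁' v₂' h4 h2'
  have e' := key_aux P A γ s u₂' v₂' u₂ v₁ v₂ h4' h2
  have hg : (γ : ℂ) ≠ 0 := by exact_mod_cast hγ
  have hc : ∀ x y : Fin n → ℂ, (starRingEnd ℂ) (star x ⬝ᵥ y) = star y ⬝ᵥ x := by
    intro x y
    rw [starRingEnd_apply, Matrix.star_dotProduct, star_star]
  apply mul_left_cancel₀ hg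
  have e2 := congrArg (starRingEnd ℂ) e'
  rw [map_mul, map_sub, map_mul, map_mul, Complex.conj_ofReal, Complex.conj_ofReal,
    hc u₂' u₂, hc v₂' v₂] at e2
  rw [e, e2]
end

section
/- Let P and A be complex n×n matrices, let γ and s be real numbers with γ ≠ 0, and suppose the vectors (u₁,u₂,v₁,v₂) in ℂⁿ form a singular pair for F = [[P,0],[γA,P]] with singular value s. Then the complex number u₂ᴴ A v₁ is real and equals (s/γ)·(‖u₂‖² − ‖v₂‖²). -/
open Matrix

/-- For a singular pair of `F = [[P,0],[γA,P]]` with singular value `s` and `γ ≠ 0`,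
the number `u₂ᴴ A v₁` is real and equals `(s/γ)·(‖u₂‖² − ‖v₂‖²)`. -/
theorem stmt_2 (n : ℕ) (P A : Matrix (Fin n) (Fin n) ℂ) (γ s : ℝ) (hγ : γ ≠ 0)
    (u₁ u₂ v₁ v₂ : Fin n → ℂ)
    (h1 : P.mulVec v₁ = (s : ℂ) • u₁)
    (h2 : (γ : ℂ) • A.mulVec v₁ + P.mulVec v₂ = (s : ℂ) • u₂)
    (h3 : Pᴴ.mulVec u₁ + (γ : ℂ) • Aᴴ.mulVec u₂ = (s : ℂ) • v₁)
    (h4 : Pᴴ.mulVec u₂ = (s : ℂ) • v₂) :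
    star u₂ ⬝ᵥ A.mulVec v₁ =
      (((s / γ) * (‖(EuclideanSpace.equiv (Fin n) ℂ).symm u₂‖ ^ 2
        - ‖(EuclideanSpace.equiv (Fin n) ℂ).symm v₂‖ ^ 2) : ℝ) : ℂ) := by
  have key : ∀ w : Fin n → ℂ, star w ⬝ᵥ w =
      ((‖(EuclideanSpace.equiv (Fin n) ℂ).symm w‖ ^ 2 : ℝ) : ℂ) := by
    intro w
    rw [EuclideanSpace.norm_sq_eq]
    simp only [dotProduct, Pi.star_apply]
    push_cast
    refine Finset.sum_congr rfl fun i _ => ?_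
    exact Complex.conj_mul' (w i)
  have hP : star u₂ ⬝ᵥ P.mulVec v₂ = (s : ℂ) * (star v₂ ⬝ᵥ v₂) := by
    have h := congrArg star h4
    rw [star_mulVec, conjTranspose_conjTranspose] at h
    rw [dotProduct_mulVec, h]
    simp
  have h := congrArg (fun x => star u₂ ⬝ᵥ x) h2
  simp only [dotProduct_add, dotProduct_smul, smul_eq_mul] at h
  rw [hP, key, key] at h
  have hγ' : (γ : ℂ) ≠ 0 := by exact_mod_cast hγ
  rw [Complex.ofReal_mul, Complex.ofReal_div, Complex.ofReal_sub]
  field_simp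
  linear_combination h
end

section
/- Let P and A be complex n×n matrices, γ and s real numbers with γ ≠ 0 and s ≠ 0, and suppose the vectors (u₁,u₂,v₁,v₂) in ℂⁿ form a singular pair for F = [[P,0],[γA,P]] with singular value s. If u₂ᴴ A v₁ = 0, then ‖u₁‖ = ‖v₁‖ and ‖u₂‖ = ‖v₂‖. -/
open Matrix

theorem aux_adj {n : ℕ} (M : Matrix (Fin n) (Fin n) ℂ) (a b : Fin n → ℂ) :
    star b ⬝ᵥ Mᴴ.mulVec a = star (star a ⬝ᵥ M.mulVec b) := by
  rw [← star_dotProduct_star, star_star, star_mulVec, dotProduct_mulVec, dotProduct_comm,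
    dotProduct_comm a, ← dotProduct_mulVec, dotProduct_comm]

theorem aux_self {n : ℕ} (a : Fin n → ℂ) :
    star a ⬝ᵥ a = ((‖(EuclideanSpace.equiv (Fin n) ℂ).symm a‖ ^ 2 : ℝ) : ℂ) := by
  rw [EuclideanSpace.norm_sq_eq]
  simp [dotProduct, Complex.conj_mul']

/-- If a singular pair of `F = [[P,0],[γA,P]]` with singular value `s ≠ 0`, `γ ≠ 0`
satisfies `u₂ᴴ A v₁ = 0`, then `‖u₁‖ = ‖v₁‖` and `‖u₂‖ = ‖v₂‖`. -/
theorem stmt_11 (n : ℕ) (P A : Matrix (Fin n) (Fin n) ℂ) (γ s : ℝ)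
    (hγ : γ ≠ 0) (hs : s ≠ 0)
    (u₁ u₂ v₁ v₂ : Fin n → ℂ)
    (h1 : P.mulVec v₁ = (s : ℂ) • u₁)
    (h2 : (γ : ℂ) • A.mulVec v₁ + P.mulVec v₂ = (s : ℂ) • u₂)
    (h3 : Pᴴ.mulVec u₁ + (γ : ℂ) • Aᴴ.mulVec u₂ = (s : ℂ) • v₁)
    (h4 : Pᴴ.mulVec u₂ = (s : ℂ) • v₂)
    (h0 : star u₂ ⬝ᵥ A.mulVec v₁ = 0) :
    ‖(EuclideanSpace.equiv (Fin n) ℂ).symm u₁‖ = ‖(EuclideanSpace.equiv (Fin n) ℂ).symm v₁‖ ∧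
    ‖(EuclideanSpace.equiv (Fin n) ℂ).symm u₂‖ = ‖(EuclideanSpace.equiv (Fin n) ℂ).symm v₂‖ := by
  have e1 := congrArg (fun x => star u₁ ⬝ᵥ x) h1
  have e2 := congrArg (fun x => star u₂ ⬝ᵥ x) h2
  have e3 := congrArg (fun x => star v₁ ⬝ᵥ x) h3
  have e4 := congrArg (fun x => star v₂ ⬝ᵥ x) h4
  simp only [dotProduct_add, dotProduct_smul, aux_adj, aux_self, h0, smul_eq_mul, mul_zero,
    star_zero, zero_add, add_zero] at e1 e2 e3 e4
  rw [e1] at e3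
  rw [e2] at e4
  simp only [← Complex.ofReal_mul, Complex.star_def, Complex.conj_ofReal, Complex.ofReal_inj]
    at e3 e4
  exact ⟨(pow_left_inj₀ (norm_nonneg _) (norm_nonneg _) two_ne_zero).1 (mul_left_cancel₀ hs e3),
    (pow_left_inj₀ (norm_nonneg _) (norm_nonneg _) two_ne_zero).1 (mul_left_cancel₀ hs e4)⟩
end
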